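/- arXiv:2210.06017 — 2 statements merged into one kernel-verified Lean document; each statement's English description precedes it below -/
import Mathlib

section
/- The monoids N1 and N2 are equationally equivalent: for every type X and all words w, w' ∈ FreeMonoid X, N1 satisfies the identity w ≍ w' if and only if N2 satisfies the identity w ≍ w'. -/
namespace Plactic

/-- The generator `a`. -/
def a : FreeMonoid (Fin 3) := FreeMonoid.of 0
/-- The generator `b`. -/
def b : FreeMonoid (Fin 3) := FreeMonoid.of 1
/-- The generator `c`. -/
def c : FreeMonoid (Fin 3) := FreeMonoid.of 2

/-- The eight Knuth relations on three generators. -/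
inductive KnuthRel : FreeMonoid (Fin 3) → FreeMonoid (Fin 3) → Prop
  | aba : KnuthRel (a * b * a) (b * a * a)
  | bab : KnuthRel (b * a * b) (b * b * a)
  | aca : KnuthRel (a * c * a) (c * a * a)
  | cac : KnuthRel (c * a * c) (c * c * a)
  | cbb : KnuthRel (c * b * b) (b * c * b)
  | cbc : KnuthRel (c * b * c) (c * c * b)
  | bac : KnuthRel (b * a * c) (b * c * a)
  | acb : KnuthRel (a * c * b) (c * a * b)

/-- The plactic congruence: the congruence generated by the Knuth relations. -/
def placticCon : Con (FreeMonoid (Fin 3)) := conGen KnuthRel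

/-- The plactic monoid with three generators. -/
abbrev M := placticCon.Quotient

/-- The natural projection from the free monoid onto the plactic monoid. -/
def mk : FreeMonoid (Fin 3) →* M := placticCon.mk'

/-- The congruence on `M` generated by the pair `(ac, ca)`. -/
def con1 : Con M := conGen (fun x y => x = mk (a * c) ∧ y = mk (c * a))

/-- `N1 = M/(ac = ca)`. -/
abbrev N1 := con1.Quotient

/-- The congruence on `M` generated by the pair `(bacb, cbab)`. -/
def con2 : Con M := conGen (fun x y => x = mk (b * a * c * b) ∧ y = mk (c * b * a * b))

/-- The grammic monoid `N2 = M/(bacb = cbab)`. -/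
abbrev N2 := con2.Quotient


/-- A monoid `S` satisfies the identity `w ≍ w'` if every monoid homomorphism
from the free monoid into `S` equalizes `w` and `w'`. -/
def SatisfiesId (S : Type*) [Monoid S] {X : Type*} (w w' : FreeMonoid X) : Prop :=
  ∀ φ : FreeMonoid X →* S, φ w = φ w'


structure Knuth {S : Type*} [Monoid S] (a b c : S) : Prop where
  aba : a * b * a = b * a * a
  bab : b * a * b = b * b * a
  aca : a * c * a = c * a * a
  cac : c * a * c = c * c * a
  cbb : c * b * b = b * c * b
  cbc : c * b * c = c * c * b
  bac : b * a * c = b * c * a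
  acb : a * c * b = c * a * b

section
variable {S : Type*} [Monoid S] {a b c : S}

/-- The row reading word. -/
def R (a b c : S) (i q s A β p : ℕ) : S :=
  c ^ i * (b ^ q * c ^ s) * (a ^ A * b ^ β * c ^ p)

theorem pow_succ_mul_of {x y : S} (h : x * y * x = x * x * y) (n : ℕ) :
    x ^ (n + 1) * y = x * y * x ^ n := by
  have hc : Commute x (x * y) := by
    unfold Commute SemiconjBy; rw [← mul_assoc, h]
  rw [pow_succ, mul_assoc, (hc.pow_left n).eq]

theorem pow_mul_pair {x y : S} (h : y * x * x = x * y * x) (n : ℕ) :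
    x ^ n * (y * x) = y * x ^ (n + 1) := by
  have hc : Commute x (y * x) := by
    unfold Commute SemiconjBy; rw [← mul_assoc, h]
  rw [(hc.pow_left n).eq, pow_succ', mul_assoc]

namespace Knuth

theorem apow_cb (h : Knuth a b c) (n : ℕ) : a ^ n * (c * b) = c * (a ^ n * b) := by
  induction n with
  | zero => simp
  | succ n ih =>
    rw [pow_succ', mul_assoc, ih]
    cases n with
    | zero => simpa [mul_assoc] using h.acb
    | succ n =>
      have := h.aca
      calc a * (c * (a ^ (n + 1) * b)) = (a * c * a) * (a ^ n * b) := by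
            rw [pow_succ']; simp only [mul_assoc]
        _ = _ := by rw [this, pow_succ']; simp only [mul_assoc]

theorem row_b (h : Knuth a b c) (A β n : ℕ) :
    a ^ A * b ^ β * c ^ (n + 1) * b = c * (a ^ A * b ^ (β + 1) * c ^ n) := by
  calc a ^ A * b ^ β * c ^ (n + 1) * b = a ^ A * b ^ β * (c ^ (n + 1) * b) := by
        simp only [mul_assoc]
    _ = a ^ A * (b ^ β * (c * b)) * c ^ n := by
        rw [pow_succ_mul_of h.cbc]; simp only [mul_assoc]
    _ = a ^ A * (c * b) * b ^ β * c ^ n := by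
        rw [pow_mul_pair h.cbb, pow_succ']; simp only [mul_assoc]
    _ = _ := by
        rw [h.apow_cb, pow_succ']; simp only [mul_assoc]

theorem b_cpow_a (h : Knuth a b c) (p : ℕ) : b * (c ^ p * a) = b * a * c ^ p := by
  cases p with
  | zero => simp
  | succ p =>
    rw [pow_succ_mul_of h.cac]
    calc b * (c * a * c ^ p) = (b * c * a) * c ^ p := by simp only [mul_assoc]
      _ = _ := by rw [← h.bac, pow_succ']; simp only [mul_assoc]

theorem row_a_b (h : Knuth a b c) (A n p : ℕ) :
    a ^ A * b ^ (n + 1) * c ^ p * a = b * (a ^ (A + 1) * b ^ n * c ^ p) := by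
  calc a ^ A * b ^ (n + 1) * c ^ p * a = a ^ A * b ^ n * (b * (c ^ p * a)) := by
        rw [pow_succ]; simp only [mul_assoc]
    _ = a ^ A * (b ^ (n + 1) * a) * c ^ p := by
        rw [h.b_cpow_a, pow_succ]; simp only [mul_assoc]
    _ = a ^ A * (b * a) * b ^ n * c ^ p := by
        rw [pow_succ_mul_of h.bab]; simp only [mul_assoc]
    _ = _ := by
        rw [pow_mul_pair h.aba.symm]; simp only [mul_assoc]

theorem row_a_c (h : Knuth a b c) (A n : ℕ) :
    a ^ A * c ^ (n + 1) * a = c * (a ^ (A + 1) * c ^ n) := by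
  rw [mul_assoc, pow_succ_mul_of h.cac, ← mul_assoc, pow_mul_pair h.aca.symm, mul_assoc]

theorem row2_b (h : Knuth a b c) (q n : ℕ) :
    b ^ q * c ^ (n + 1) * b = c * (b ^ (q + 1) * c ^ n) := by
  rw [mul_assoc, pow_succ_mul_of h.cbc, ← mul_assoc, pow_mul_pair h.cbb, mul_assoc]

theorem R_c (i q s A β p : ℕ) : R a b c i q s A β p * c = R a b c i q s A β (p + 1) := by
  unfold R; rw [pow_succ c p]; simp only [mul_assoc]

theorem R_b_zero (i q s A β : ℕ) : R a b c i q s A β 0 * b = R a b c i q s A (β + 1) 0 := by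
  unfold R; rw [pow_succ b β]; simp [mul_assoc]

theorem R_b (h : Knuth a b c) (i q s A β p : ℕ) :
    R a b c i q s A β (p + 1) * b = R a b c i q (s + 1) A (β + 1) p := by
  unfold R
  rw [mul_assoc, h.row_b, pow_succ c s]; simp only [mul_assoc]

theorem R_a_zero (i q s A : ℕ) : R a b c i q s A 0 0 * a = R a b c i q s (A + 1) 0 0 := by
  unfold R; rw [pow_succ a A]; simp [mul_assoc]

theorem R_a_c (h : Knuth a b c) (i q s A p : ℕ) :
    R a b c i q s A 0 (p + 1) * a = R a b c i q (s + 1) (A + 1) 0 p := by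
  unfold R
  rw [pow_zero, mul_one, mul_one, mul_assoc, h.row_a_c, pow_succ c s]; simp only [mul_assoc]

theorem R_a_b_zero (h : Knuth a b c) (i q A β p : ℕ) :
    R a b c i q 0 A (β + 1) p * a = R a b c i (q + 1) 0 (A + 1) β p := by
  unfold R
  rw [mul_assoc, h.row_a_b, pow_succ b q, pow_zero]; simp only [mul_assoc, one_mul]

theorem R_a_b (h : Knuth a b c) (i q s A β p : ℕ) :
    R a b c i q (s + 1) A (β + 1) p * a = R a b c (i + 1) (q + 1) s (A + 1) β p := by
  unfold R
  calc _ = c ^ i * (b ^ q * c ^ (s + 1)) * (a ^ A * b ^ (β + 1) * c ^ p * a) := by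
        simp only [mul_assoc]
    _ = c ^ i * (b ^ q * c ^ (s + 1) * b) * (a ^ (A + 1) * b ^ β * c ^ p) := by
        rw [h.row_a_b]; simp only [mul_assoc]
    _ = _ := by rw [h.row2_b, pow_succ c i]; simp only [mul_assoc]

/-- Every product of `a`, `b`, `c` is the row reading of a tableau. -/
theorem exists_R (h : Knuth a b c) (w : List (Fin 3)) :
    ∃ i q s A β p : ℕ, i ≤ q ∧ q ≤ A ∧ q + s ≤ A + β ∧
      (w.map ![a, b, c]).prod = R a b c i q s A β p := by
  induction w using List.reverseRecOn with
  | nil => exact ⟨0, 0, 0, 0, 0, 0, by simp [R]⟩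
  | append_singleton w l ih =>
    obtain ⟨i, q, s, A, β, p, h1, h2, h3, e⟩ := ih
    simp only [List.map_append, List.prod_append, e, List.map_cons, List.map_nil,
      List.prod_cons, List.prod_nil, mul_one]
    fin_cases l
    · rcases β with _ | β
      · rcases p with _ | p
        · exact ⟨_, _, _, _, _, _, h1, by omega, by omega, R_a_zero i q s A⟩
        · exact ⟨_, _, _, _, _, _, h1, by omega, by omega, h.R_a_c i q s A p⟩
      · rcases s with _ | s
        · exact ⟨_, _, _, _, _, _, by omega, by omega, by omega, h.R_a_b_zero i q A β p⟩
        · exact ⟨_, _, _, _, _, _, by omega, by omega, by omega, h.R_a_b i q s A β p⟩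
    · rcases p with _ | p
      · exact ⟨_, _, _, _, _, _, h1, by omega, by omega, R_b_zero i q s A β⟩
      · exact ⟨_, _, _, _, _, _, h1, by omega, by omega, h.R_b i q s A β p⟩
    · exact ⟨_, _, _, _, _, _, h1, by omega, by omega, R_c i q s A β p⟩

/-- `c^n b^n` is a power of `cb`. -/
theorem cpow_bpow (h : Knuth a b c) (n : ℕ) : c ^ n * b ^ n = (c * b) ^ n := by
  induction n with
  | zero => simp
  | succ n ih =>
    rw [pow_succ_mul_pow h n, ih, pow_succ']
where
  pow_succ_mul_pow (h : Knuth a b c) (n : ℕ) :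
      c ^ (n + 1) * b ^ (n + 1) = c * b * (c ^ n * b ^ n) := by
    rw [pow_succ' b, ← mul_assoc, pow_succ_mul_of h.cbc, mul_assoc]

theorem comm_c (h : Knuth a b c) (n : ℕ) : c ^ n * b ^ n * c = c * (c ^ n * b ^ n) := by
  rw [h.cpow_bpow]
  have hc : Commute (c * b) c := by
    unfold Commute SemiconjBy; rw [h.cbc, mul_assoc]
  exact (hc.pow_left n).eq

/-- The relation specific to `N1`. -/
theorem N1_step (h : Knuth a b c) (hac : a * c = c * a) (i q t A β p : ℕ) :
    R a b c i q (β + t) A β (p + 1) = R a b c i q (β + t + 1) A β p := by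
  have hc : Commute a c := hac
  unfold R
  have e : c ^ β * (a ^ A * b ^ β * c) = c * (c ^ β * (a ^ A * b ^ β)) := by
    calc c ^ β * (a ^ A * b ^ β * c) = (c ^ β * a ^ A) * b ^ β * c := by
          simp only [mul_assoc]
      _ = a ^ A * (c ^ β * b ^ β * c) := by
          rw [← (hc.pow_pow A β).eq]; simp only [mul_assoc]
      _ = (a ^ A * c ^ (β + 1)) * b ^ β := by
          rw [h.comm_c, pow_succ']; simp only [mul_assoc]
      _ = _ := by rw [(hc.pow_pow A (β + 1)).eq, pow_succ']; simp only [mul_assoc]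
  calc _ = c ^ i * (b ^ q * c ^ t) * (c ^ β * (a ^ A * b ^ β * c)) * c ^ p := by
        rw [add_comm β t, pow_add, pow_succ' c p]; simp only [mul_assoc]
    _ = _ := by
        rw [e, show β + t + 1 = t + (1 + β) by omega, pow_add, pow_add, pow_one]
        simp only [mul_assoc]

theorem N1_steps (h : Knuth a b c) (hac : a * c = c * a) (i q t A β p n : ℕ) :
    R a b c i q (β + t) A β (p + n) = R a b c i q (β + t + n) A β p := by
  induction n generalizing t with
  | zero => rfl
  | succ n ih =>
    rw [← add_assoc p n 1, h.N1_step hac, add_assoc β t 1, ih]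
    congr 1; omega

theorem cpow_row (h : Knuth a b c) (A n : ℕ) : c ^ n * (a ^ A * b ^ n) = a ^ A * (c * b) ^ n := by
  induction n with
  | zero => simp
  | succ n ih =>
    have hc : Commute (c * b) b := by
      unfold Commute SemiconjBy; rw [h.cbb, mul_assoc]
    calc c ^ (n + 1) * (a ^ A * b ^ (n + 1)) = c ^ n * (c * (a ^ A * b)) * b ^ n := by
          rw [pow_succ, pow_succ']; simp only [mul_assoc]
      _ = c ^ n * a ^ A * ((c * b) * b ^ n) := by
          rw [← h.apow_cb]; simp only [mul_assoc]
      _ = c ^ n * (a ^ A * b ^ n) * (c * b) := by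
          rw [(hc.pow_right n).eq]; simp only [mul_assoc]
      _ = _ := by rw [ih, pow_succ]; simp only [mul_assoc]

theorem cba_a (h : Knuth a b c) : Commute a (c * b * a) := by
  unfold Commute SemiconjBy
  calc a * (c * b * a) = (a * c * b) * a := by simp only [mul_assoc]
    _ = c * (a * b * a) := by rw [h.acb]; simp only [mul_assoc]
    _ = _ := by rw [h.aba]; simp only [mul_assoc]

/-- The relation specific to `N2`. -/
theorem N2_core (h : Knuth a b c) (hg : b * a * c * b = c * b * a * b) (A s : ℕ) :
    b * (c ^ (s + 1) * (a ^ (A + 1) * b ^ (s + 1)))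
      = c * b * (c ^ s * (a ^ (A + 1) * b ^ (s + 1))) := by
  have hc : Commute (c * b) b := by
    unfold Commute SemiconjBy; rw [h.cbb, mul_assoc]
  calc b * (c ^ (s + 1) * (a ^ (A + 1) * b ^ (s + 1)))
      = (b * a ^ (A + 1)) * (c * b) ^ (s + 1) := by rw [h.cpow_row]; simp only [mul_assoc]
    _ = a ^ A * (b * a * c * b) * (c * b) ^ s := by
        rw [← pow_mul_pair h.aba.symm, pow_succ']; simp only [mul_assoc]
    _ = a ^ A * (c * b * a) * (b * (c * b) ^ s) := by
        rw [hg]; simp only [mul_assoc]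
    _ = (c * b * a) * a ^ A * ((c * b) ^ s * b) := by
        rw [(h.cba_a.pow_left A).eq, (hc.pow_left s).eq]
    _ = c * b * (a ^ (A + 1) * (c * b) ^ s) * b := by
        rw [pow_succ']; simp only [mul_assoc]
    _ = _ := by rw [← h.cpow_row, pow_succ b s]; simp only [mul_assoc]

theorem N2_step (h : Knuth a b c) (hg : b * a * c * b = c * b * a * b) (i q s A t p : ℕ) :
    R a b c i (q + 1) (s + 1) (A + 1) (s + 1 + t) p
      = R a b c (i + 1) (q + 1) s (A + 1) (s + 1 + t) p := by
  unfold R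
  calc _ = c ^ i * b ^ q * (b * (c ^ (s + 1) * (a ^ (A + 1) * b ^ (s + 1)))) * b ^ t * c ^ p := by
        rw [pow_succ b q, pow_add b (s + 1) t]; simp only [mul_assoc]
    _ = c ^ i * (b ^ q * (c * b)) * (c ^ s * (a ^ (A + 1) * b ^ (s + 1))) * b ^ t * c ^ p := by
        rw [h.N2_core hg]; simp only [mul_assoc]
    _ = _ := by
        rw [pow_mul_pair h.cbb, pow_succ c i, pow_add b (s + 1) t]; simp only [mul_assoc]

theorem N2_steps (h : Knuth a b c) (hg : b * a * c * b = c * b * a * b) (i q s A β p n : ℕ)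
    (h1 : i + n ≤ q) (h2 : q ≤ A) (h3 : s + n ≤ β) :
    R a b c i q (s + n) A β p = R a b c (i + n) q s A β p := by
  induction n generalizing i with
  | zero => rfl
  | succ n ih =>
    obtain ⟨q, rfl⟩ : ∃ q', q = q' + 1 := ⟨q - 1, by omega⟩
    obtain ⟨A, rfl⟩ : ∃ A', A = A' + 1 := ⟨A - 1, by omega⟩
    obtain ⟨t, rfl⟩ : ∃ t, β = s + n + 1 + t := ⟨β - (s + n + 1), by omega⟩
    rw [← add_assoc s n 1, h.N2_step hg, ih (i + 1) (by omega) (by omega)]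
    congr 1; omega

end Knuth

end

/-! ### The numerical invariants -/

/-- Two heights, their running maxima, and the running maximum of
`x` at an earlier time plus `y` at a later time. -/
@[ext]
structure St where
  x : ℤ
  y : ℤ
  mx : ℤ
  my : ℤ
  W : ℤ

/-- The step with weights `u`, `v`. -/
def step (u v : ℤ) (s : St) : St where
  x := s.x + u
  y := s.y + v
  mx := max s.mx (s.x + u)
  my := max s.my (s.y + v)
  W := max s.W (max s.mx (s.x + u) + (s.y + v))

/-- Valid states. -/
def Valid (s : St) : Prop := s.x ≤ s.mx ∧ s.y ≤ s.my ∧ s.mx + s.y ≤ s.W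

theorem valid_step (u v : ℤ) (s : St) : Valid (step u v s) := by
  simp only [Valid, step]; omega

/-- Weights `(x, y)` of a letter. -/
abbrev Wt := Fin 3 → ℤ × ℤ

def wt1 : Wt := ![(0, 1), (1, -1), (-1, 0)]
def wt2 : Wt := ![(1, 0), (-1, 1), (0, -1)]

/-- Running a word on a state. -/
def run (k : Wt) (w : FreeMonoid (Fin 3)) (s : St) : St :=
  (FreeMonoid.toList w).foldl (fun s l => step (k l).1 (k l).2 s) s

theorem run_one (k : Wt) (s : St) : run k 1 s = s := by simp [run]

theorem run_mul (k : Wt) (u v : FreeMonoid (Fin 3)) (s : St) :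
    run k (u * v) s = run k v (run k u s) := by simp [run]

theorem run_of (k : Wt) (l : Fin 3) (s : St) :
    run k (FreeMonoid.of l) s = step (k l).1 (k l).2 s := by simp [run]

theorem valid_run (k : Wt) (w : FreeMonoid (Fin 3)) {s : St} (hs : Valid s) :
    Valid (run k w s) := by
  induction w using FreeMonoid.recOn generalizing s with
  | one => simpa [run_one]
  | of_mul l w ih => rw [run_mul, run_of]; exact ih (valid_step _ _ _)

/-- The congruence of words with the same invariants. -/
def K (k : Wt) : Con (FreeMonoid (Fin 3)) where
  r u v := u.length = v.length ∧ ∀ s, Valid s → run k u s = run k v s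
  iseqv := ⟨fun _ => ⟨rfl, fun _ _ => rfl⟩,
    fun h => ⟨h.1.symm, fun s hs => (h.2 s hs).symm⟩,
    fun h h' => ⟨h.1.trans h'.1, fun s hs => (h.2 s hs).trans (h'.2 s hs)⟩⟩
  mul' := by
    intro u v u' v' h h'
    refine ⟨by rw [FreeMonoid.length_mul, FreeMonoid.length_mul, h.1, h'.1], fun s hs => ?_⟩
    rw [run_mul, run_mul, h.2 s hs, h'.2 _ (valid_run _ _ hs)]

theorem K_iff (k : Wt) (u v : FreeMonoid (Fin 3)) :
    K k u v ↔ u.length = v.length ∧ ∀ s, Valid s → run k u s = run k v s := Iff.rfl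

theorem St.ext_iff' (s t : St) :
    s = t ↔ s.x = t.x ∧ s.y = t.y ∧ s.mx = t.mx ∧ s.my = t.my ∧ s.W = t.W := St.ext_iff

set_option maxHeartbeats 4000000 in
theorem knuth_le_K1 : placticCon ≤ K wt1 := by
  refine Con.conGen_le.mpr ?_
  intro u v h
  refine ⟨by cases h <;> rfl, fun s hs => ?_⟩
  obtain ⟨h1, h2, h3⟩ := hs
  cases h <;>
  · simp only [a, b, c, run_mul, run_of, wt1, step, St.ext_iff', Matrix.cons_val]
    omega

set_option maxHeartbeats 4000000 in
theorem knuth_le_K2 : placticCon ≤ K wt2 := by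
  refine Con.conGen_le.mpr ?_
  intro u v h
  refine ⟨by cases h <;> rfl, fun s hs => ?_⟩
  obtain ⟨h1, h2, h3⟩ := hs
  cases h <;>
  · simp only [a, b, c, run_mul, run_of, wt2, step, St.ext_iff', Matrix.cons_val]
    omega

theorem K1_ac : K wt1 (a * c) (c * a) := by
  refine ⟨rfl, fun s hs => ?_⟩
  obtain ⟨h1, h2, h3⟩ := hs
  simp only [a, b, c, run_mul, run_of, wt1, step, St.ext_iff', Matrix.cons_val]
  omega

theorem K2_bacb : K wt2 (b * a * c * b) (c * b * a * b) := by
  refine ⟨rfl, fun s hs => ?_⟩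
  obtain ⟨h1, h2, h3⟩ := hs
  simp only [a, b, c, run_mul, run_of, wt2, step, St.ext_iff', Matrix.cons_val]
  omega

/-- Projections. -/
def π1 : FreeMonoid (Fin 3) →* N1 := con1.mk'.comp mk
def π2 : FreeMonoid (Fin 3) →* N2 := con2.mk'.comp mk

theorem quot_sound {k : Wt} (hk : placticCon ≤ K k) {p q : FreeMonoid (Fin 3)} (hpq : K k p q)
    {u v : FreeMonoid (Fin 3)}
    (h : conGen (fun x y => x = mk p ∧ y = mk q) (mk u) (mk v)) : K k u v := by
  let f : M →* (K k).Quotient := placticCon.lift (K k).mk' (by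
    intro x y hxy
    exact (Con.eq _).mpr (hk hxy))
  have hf : ∀ z, f (mk z) = (K k).mk' z := fun z => rfl
  have hle : conGen (fun x y => x = mk p ∧ y = mk q) ≤ Con.ker f := by
    refine Con.conGen_le.mpr ?_
    rintro x y ⟨rfl, rfl⟩
    change f _ = f _
    rw [hf, hf]
    exact (Con.eq _).mpr hpq
  have := hle h
  change f _ = f _ at this
  rw [hf, hf] at this
  exact (Con.eq _).mp this

theorem sound1 {u v : FreeMonoid (Fin 3)} (h : π1 u = π1 v) : K wt1 u v :=
  quot_sound knuth_le_K1 K1_ac ((Con.eq _).mp h)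

theorem sound2 {u v : FreeMonoid (Fin 3)} (h : π2 u = π2 v) : K wt2 u v :=
  quot_sound knuth_le_K2 K2_bacb ((Con.eq _).mp h)

theorem knuth_M : Knuth (mk a) (mk b) (mk c) := by
  constructor <;> simp only [← map_mul] <;> refine (Con.eq _).mpr (ConGen.Rel.of _ _ ?_)
  · exact .aba
  · exact .bab
  · exact .aca
  · exact .cac
  · exact .cbb
  · exact .cbc
  · exact .bac
  · exact .acb

theorem Knuth.map {S T : Type*} [Monoid S] [Monoid T] (f : S →* T) {a b c : S}
    (h : Knuth a b c) : Knuth (f a) (f b) (f c) := by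
  constructor <;> simp only [← map_mul]
  · rw [h.aba]
  · rw [h.bab]
  · rw [h.aca]
  · rw [h.cac]
  · rw [h.cbb]
  · rw [h.cbc]
  · rw [h.bac]
  · rw [h.acb]

theorem map_R {S T : Type*} [Monoid S] [Monoid T] (f : S →* T) (a b c : S) (i q s A β p : ℕ) :
    f (R a b c i q s A β p) = R (f a) (f b) (f c) i q s A β p := by
  simp [R]

theorem mk_eq_prod (w : FreeMonoid (Fin 3)) :
    mk w = ((FreeMonoid.toList w).map ![mk a, mk b, mk c]).prod := by
  induction w using FreeMonoid.recOn with
  | one => simp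
  | of_mul l w ih =>
    rw [map_mul, ih]
    fin_cases l <;> simp [a, b, c]

theorem exists_mk_R (w : FreeMonoid (Fin 3)) :
    ∃ i q s A β p : ℕ, i ≤ q ∧ q ≤ A ∧ q + s ≤ A + β ∧
      mk w = mk (R a b c i q s A β p) := by
  obtain ⟨i, q, s, A, β, p, h1, h2, h3, e⟩ := knuth_M.exists_R (FreeMonoid.toList w)
  exact ⟨i, q, s, A, β, p, h1, h2, h3, by rw [mk_eq_prod, e, map_R]⟩

theorem run_pow1 (n : ℕ) (s : St) (hs : Valid s) :
    run wt1 (a ^ n) s = step 0 n s ∧ run wt1 (b ^ n) s = step n (-n) s ∧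
      run wt1 (c ^ n) s = step (-n) 0 s := by
  induction n with
  | zero =>
    obtain ⟨h1, h2, h3⟩ := hs
    simp only [pow_zero, run_one, step, St.ext_iff']
    omega
  | succ n ih =>
    obtain ⟨e1, e2, e3⟩ := ih
    obtain ⟨h1, h2, h3⟩ := hs
    rw [pow_succ, pow_succ, pow_succ, run_mul, run_mul, run_mul, e1, e2, e3]
    simp only [a, b, c, run_of, wt1, step, St.ext_iff', Matrix.cons_val]
    push_cast
    omega

theorem run_pow2 (n : ℕ) (s : St) (hs : Valid s) :
    run wt2 (a ^ n) s = step n 0 s ∧ run wt2 (b ^ n) s = step (-n) n s ∧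
      run wt2 (c ^ n) s = step 0 (-n) s := by
  induction n with
  | zero =>
    obtain ⟨h1, h2, h3⟩ := hs
    simp only [pow_zero, run_one, step, St.ext_iff']
    omega
  | succ n ih =>
    obtain ⟨e1, e2, e3⟩ := ih
    obtain ⟨h1, h2, h3⟩ := hs
    rw [pow_succ, pow_succ, pow_succ, run_mul, run_mul, run_mul, e1, e2, e3]
    simp only [a, b, c, run_of, wt2, step, St.ext_iff', Matrix.cons_val]
    push_cast
    omega

/-- Initial state. -/
def s0 : St := ⟨0, 0, 0, 0, 0⟩

theorem valid_s0 : Valid s0 := by simp [Valid, s0]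

theorem length_pow' (w : FreeMonoid (Fin 3)) (n : ℕ) : (w ^ n).length = n * w.length := by
  induction n with
  | zero => simp
  | succ n ih => rw [pow_succ, FreeMonoid.length_mul, ih]; ring

theorem length_R (i q s A β p : ℕ) : (R a b c i q s A β p).length = i + q + s + A + β + p := by
  simp only [R, FreeMonoid.length_mul, length_pow', a, b, c, FreeMonoid.length_of]
  ring

theorem run_R1 (i q s A β p : ℕ) (h1 : i ≤ q) (h2 : q ≤ A) (h3 : q + s ≤ A + β) :
    run wt1 (R a b c i q s A β p) s0 =
      ⟨(q : ℤ) + β - i - s - p, (A : ℤ) - q - β, (q : ℤ) - i + max 0 ((β : ℤ) - s),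
        (A : ℤ) - q, (A : ℤ) - i⟩ := by
  have v0 := valid_s0
  simp only [R, run_mul]
  rw [(run_pow1 i _ v0).2.2, (run_pow1 q _ (valid_step _ _ _)).2.1,
    (run_pow1 s _ (valid_step _ _ _)).2.2, (run_pow1 A _ (valid_step _ _ _)).1,
    (run_pow1 β _ (valid_step _ _ _)).2.1, (run_pow1 p _ (valid_step _ _ _)).2.2]
  simp only [step, s0, St.ext_iff']
  refine ⟨?_, ?_, ?_, ?_, ?_⟩ <;> grind

theorem run_R2 (i q s A β p : ℕ) (h1 : i ≤ q) (h2 : q ≤ A) (h3 : q + s ≤ A + β) :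
    run wt2 (R a b c i q s A β p) s0 =
      ⟨(A : ℤ) - q - β, (q : ℤ) + β - i - s - p, (A : ℤ) - q,
        (q : ℤ) - i + max 0 ((β : ℤ) - s), (A : ℤ) + β - i - s⟩ := by
  have v0 := valid_s0
  simp only [R, run_mul]
  rw [(run_pow2 i _ v0).2.2, (run_pow2 q _ (valid_step _ _ _)).2.1,
    (run_pow2 s _ (valid_step _ _ _)).2.2, (run_pow2 A _ (valid_step _ _ _)).1,
    (run_pow2 β _ (valid_step _ _ _)).2.1, (run_pow2 p _ (valid_step _ _ _)).2.2]
  simp only [step, s0, St.ext_iff']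
  refine ⟨?_, ?_, ?_, ?_, ?_⟩ <;> grind

theorem mk_K {k : Wt} (hk : placticCon ≤ K k) {u v : FreeMonoid (Fin 3)} (h : mk u = mk v) :
    K k u v := hk ((Con.eq _).mp h)

theorem complete1 {u v : FreeMonoid (Fin 3)} (h : K wt1 u v) : π1 u = π1 v := by
  obtain ⟨i, q, s, A, β, p, h1, h2, h3, e⟩ := exists_mk_R u
  obtain ⟨i', q', s', A', β', p', h1', h2', h3', e'⟩ := exists_mk_R v
  have hK : K wt1 (R a b c i q s A β p) (R a b c i' q' s' A' β' p') :=
    (K wt1).trans ((K wt1).symm (mk_K knuth_le_K1 e)) ((K wt1).trans h (mk_K knuth_le_K1 e'))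
  have hl := hK.1
  have hr := hK.2 s0 valid_s0
  rw [length_R, length_R] at hl
  rw [run_R1 _ _ _ _ _ _ h1 h2 h3, run_R1 _ _ _ _ _ _ h1' h2' h3'] at hr
  simp only [St.ext_iff'] at hr
  obtain ⟨r1, r2, r3, r4, r5⟩ := hr
  have kN := knuth_M.map con1.mk'
  have hac : con1.mk' (mk a) * con1.mk' (mk c) = con1.mk' (mk c) * con1.mk' (mk a) := by
    rw [← map_mul, ← map_mul, ← map_mul, ← map_mul]
    exact (Con.eq _).mpr (ConGen.Rel.of _ _ ⟨rfl, rfl⟩)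
  change con1.mk' (mk u) = con1.mk' (mk v)
  rw [e, e', map_R, map_R, map_R, map_R]
  obtain rfl : A = A' := by omega
  obtain rfl : i = i' := by omega
  obtain rfl : q = q' := by omega
  obtain rfl : β = β' := by omega
  by_cases hs : s = s'
  · obtain rfl : p = p' := by omega
    rw [hs]
  · have hb : β ≤ s ∧ β ≤ s' := by omega
    obtain ⟨t, rfl⟩ := Nat.exists_eq_add_of_le hb.1
    obtain ⟨t', rfl⟩ := Nat.exists_eq_add_of_le hb.2
    rcases le_total p p' with hp | hp
    · obtain ⟨n, rfl⟩ := Nat.exists_eq_add_of_le hp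
      rw [kN.N1_steps hac]
      congr 1; omega
    · obtain ⟨n, rfl⟩ := Nat.exists_eq_add_of_le hp
      rw [kN.N1_steps hac]
      congr 1; omega

theorem complete2 {u v : FreeMonoid (Fin 3)} (h : K wt2 u v) : π2 u = π2 v := by
  obtain ⟨i, q, s, A, β, p, h1, h2, h3, e⟩ := exists_mk_R u
  obtain ⟨i', q', s', A', β', p', h1', h2', h3', e'⟩ := exists_mk_R v
  have hK : K wt2 (R a b c i q s A β p) (R a b c i' q' s' A' β' p') :=
    (K wt2).trans ((K wt2).symm (mk_K knuth_le_K2 e)) ((K wt2).trans h (mk_K knuth_le_K2 e'))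
  have hl := hK.1
  have hr := hK.2 s0 valid_s0
  rw [length_R, length_R] at hl
  rw [run_R2 _ _ _ _ _ _ h1 h2 h3, run_R2 _ _ _ _ _ _ h1' h2' h3'] at hr
  simp only [St.ext_iff'] at hr
  obtain ⟨r1, r2, r3, r4, r5⟩ := hr
  have kN := knuth_M.map con2.mk'
  have hg : con2.mk' (mk b) * con2.mk' (mk a) * con2.mk' (mk c) * con2.mk' (mk b)
      = con2.mk' (mk c) * con2.mk' (mk b) * con2.mk' (mk a) * con2.mk' (mk b) := by
    simp only [← map_mul]
    exact (Con.eq _).mpr (ConGen.Rel.of _ _ ⟨rfl, rfl⟩)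
  change con2.mk' (mk u) = con2.mk' (mk v)
  rw [e, e', map_R, map_R, map_R, map_R]
  obtain rfl : A = A' := by omega
  obtain rfl : q = q' := by omega
  obtain rfl : β = β' := by omega
  obtain rfl : p = p' := by omega
  by_cases hs : s = s'
  · obtain rfl : i = i' := by omega
    rw [hs]
  · rcases le_total s s' with hp | hp
    · obtain ⟨n, rfl⟩ := Nat.exists_eq_add_of_le hp
      obtain rfl : i = i' + n := by omega
      exact (kN.N2_steps hg _ _ _ _ _ _ _ (by omega) (by omega) (by omega)).symm
    · obtain ⟨n, rfl⟩ := Nat.exists_eq_add_of_le hp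
      obtain rfl : i' = i + n := by omega
      exact kN.N2_steps hg _ _ _ _ _ _ _ (by omega) (by omega) (by omega)

/-- The two substitutions. -/
def σ : FreeMonoid (Fin 3) →* FreeMonoid (Fin 3) := FreeMonoid.lift ![b * a, a * c, c * b]
def τ : FreeMonoid (Fin 3) →* FreeMonoid (Fin 3) := FreeMonoid.lift ![b * a, c * a, c * b]

theorem run_σ (w : FreeMonoid (Fin 3)) (s : St) (hs : Valid s) :
    run wt1 (σ w) s = run wt2 w s := by
  induction w using FreeMonoid.recOn generalizing s with
  | one => simp [run_one]
  | of_mul l w ih =>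
    rw [map_mul, run_mul, run_mul, ← ih _ (valid_run _ _ hs)]
    congr 1
    obtain ⟨h1, h2, h3⟩ := hs
    fin_cases l <;>
    · simp only [σ, FreeMonoid.lift_eval_of, a, b, c, run_mul, run_of, wt1, wt2, step, St.ext_iff',
        Matrix.cons_val, Fin.zero_eta, Fin.mk_one, Fin.reduceFinMk]
      omega

theorem run_τ (w : FreeMonoid (Fin 3)) (s : St) (hs : Valid s) :
    run wt2 (τ w) s = run wt1 w s := by
  induction w using FreeMonoid.recOn generalizing s with
  | one => simp [run_one]
  | of_mul l w ih =>
    rw [map_mul, run_mul, run_mul, ← ih _ (valid_run _ _ hs)]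
    congr 1
    obtain ⟨h1, h2, h3⟩ := hs
    fin_cases l <;>
    · simp only [τ, FreeMonoid.lift_eval_of, a, b, c, run_mul, run_of, wt1, wt2, step, St.ext_iff',
        Matrix.cons_val, Fin.zero_eta, Fin.mk_one, Fin.reduceFinMk]
      omega

theorem length_σ (w : FreeMonoid (Fin 3)) : (σ w).length = 2 * w.length := by
  induction w using FreeMonoid.recOn with
  | one => simp
  | of_mul l w ih =>
    rw [map_mul, FreeMonoid.length_mul, FreeMonoid.length_mul, ih]
    fin_cases l <;> simp [σ, a, b, c] <;> ring

theorem length_τ (w : FreeMonoid (Fin 3)) : (τ w).length = 2 * w.length := by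
  induction w using FreeMonoid.recOn with
  | one => simp
  | of_mul l w ih =>
    rw [map_mul, FreeMonoid.length_mul, FreeMonoid.length_mul, ih]
    fin_cases l <;> simp [τ, a, b, c] <;> ring

theorem K_of_σ {u v : FreeMonoid (Fin 3)} (h : K wt1 (σ u) (σ v)) : K wt2 u v := by
  refine ⟨?_, fun s hs => ?_⟩
  · have := h.1
    rw [length_σ, length_σ] at this
    omega
  · rw [← run_σ u s hs, ← run_σ v s hs]; exact h.2 s hs

theorem K_of_τ {u v : FreeMonoid (Fin 3)} (h : K wt2 (τ u) (τ v)) : K wt1 u v := by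
  refine ⟨?_, fun s hs => ?_⟩
  · have := h.1
    rw [length_τ, length_τ] at this
    omega
  · rw [← run_τ u s hs, ← run_τ v s hs]; exact h.2 s hs

theorem lift_hom {S : Type*} [Monoid S] (π : FreeMonoid (Fin 3) →* S)
    (hπ : Function.Surjective π) {X : Type*} (φ : FreeMonoid X →* S) :
    ∃ ψ : FreeMonoid X →* FreeMonoid (Fin 3), ∀ w, φ w = π (ψ w) := by
  choose g hg using fun x : X => hπ (φ (FreeMonoid.of x))
  refine ⟨FreeMonoid.lift g, fun w => ?_⟩
  have : φ = π.comp (FreeMonoid.lift g) := by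
    ext x; simp [hg]
  rw [this]; rfl

theorem π1_surj : Function.Surjective π1 :=
  (Con.mk'_surjective (c := con1)).comp (Con.mk'_surjective (c := placticCon))

theorem π2_surj : Function.Surjective π2 :=
  (Con.mk'_surjective (c := con2)).comp (Con.mk'_surjective (c := placticCon))

/-- The monoids `N1` and `N2` are equationally equivalent. -/
theorem N1_equationally_equivalent_N2 :
    ∀ (X : Type*) (w w' : FreeMonoid X),
      SatisfiesId N1 w w' ↔ SatisfiesId N2 w w' := by
  intro X w w'
  constructor
  · intro h φ
    obtain ⟨ψ, hψ⟩ := lift_hom π2 π2_surj φ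
    rw [hψ, hψ]
    exact complete2 (K_of_σ (sound1 (h (π1.comp (σ.comp ψ)))))
  · intro h φ
    obtain ⟨ψ, hψ⟩ := lift_hom π1 π1_surj φ
    rw [hψ, hψ]
    exact complete1 (K_of_τ (sound2 (h (π2.comp (τ.comp ψ)))))

end Plactic
end

section
/- The grammic monoid N2 and its quotient N2' := N2/(cba = 1) (the quotient of N2 by the congruence generated by the pair (z, 1), where z is the image in N2 of the word cba) are equationally equivalent: for every type X and all words w, w' ∈ FreeMonoid X, N2 satisfies the identity w ≍ w' if and only if N2' satisfies the identity w ≍ w'. -/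
namespace Plactic

/-- The congruence on `N2` generated by the pair `(z, 1)`, where `z` is the
image of `cba` in `N2`. -/
def conN2' : Con N2 := conGen (fun x y => x = con2.mk' (mk (c * b * a)) ∧ y = 1)

/-- `N2' = N2/(cba = 1)`. -/
abbrev N2' := conN2'.Quotient

section Words

/-- The defining relations of `N2` for three elements of a monoid. -/
structure GrammicRel {S : Type*} [Monoid S] (a b c : S) : Prop where
  aba : a * b * a = b * a * a
  bab : b * a * b = b * b * a
  aca : a * c * a = c * a * a
  cac : c * a * c = c * c * a
  cbb : c * b * b = b * c * b
  cbc : c * b * c = c * c * b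
  bac : b * a * c = b * c * a
  acb : a * c * b = c * a * b
  key : b * a * c * b = c * b * a * b

variable {S : Type*} [Monoid S] {a b c : S}

/-- The words used for the normal form. -/
def W (a b c : S) (t p m n j q l : ℕ) : S :=
  (c * b * a) ^ t * ((b * a) ^ p * ((c * a) ^ m * (a ^ n * ((c * b) ^ j * (b ^ q * c ^ l)))))

namespace GrammicRel

lemma za (h : GrammicRel a b c) : Commute (c * b * a) a := by
  show c * b * a * a = a * (c * b * a)
  calc c * b * a * a = c * (b * a * a) := by simp only [mul_assoc]
    _ = c * (a * b * a) := by rw [h.aba]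
    _ = (c * a * b) * a := by simp only [mul_assoc]
    _ = (a * c * b) * a := by rw [h.acb]
    _ = _ := by simp only [mul_assoc]

lemma zb (h : GrammicRel a b c) : Commute (c * b * a) b := by
  show c * b * a * b = b * (c * b * a)
  calc c * b * a * b = c * (b * a * b) := by simp only [mul_assoc]
    _ = c * (b * b * a) := by rw [h.bab]
    _ = (c * b * b) * a := by simp only [mul_assoc]
    _ = (b * c * b) * a := by rw [h.cbb]
    _ = _ := by simp only [mul_assoc]

lemma zc (h : GrammicRel a b c) : Commute (c * b * a) c := by
  show c * b * a * c = c * (c * b * a)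
  calc c * b * a * c = c * (b * a * c) := by simp only [mul_assoc]
    _ = c * (b * c * a) := by rw [h.bac]
    _ = (c * b * c) * a := by simp only [mul_assoc]
    _ = (c * c * b) * a := by rw [h.cbc]
    _ = _ := by simp only [mul_assoc]

lemma alpha_a (h : GrammicRel a b c) : Commute (b * a) a := by
  show b * a * a = a * (b * a)
  rw [← h.aba, mul_assoc]

lemma alpha_b (h : GrammicRel a b c) : Commute (b * a) b := by
  show b * a * b = b * (b * a)
  rw [h.bab, mul_assoc]

lemma delta_a (h : GrammicRel a b c) : Commute (c * a) a := by
  show c * a * a = a * (c * a)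
  rw [← h.aca, mul_assoc]

lemma delta_c (h : GrammicRel a b c) : Commute (c * a) c := by
  show c * a * c = c * (c * a)
  rw [h.cac, mul_assoc]

lemma gamma_b (h : GrammicRel a b c) : Commute (c * b) b := by
  show c * b * b = b * (c * b)
  rw [h.cbb, mul_assoc]

lemma gamma_c (h : GrammicRel a b c) : Commute (c * b) c := by
  show c * b * c = c * (c * b)
  rw [h.cbc, mul_assoc]

lemma alpha_gamma (h : GrammicRel a b c) : (b * a) * (c * b) = (c * b * a) * b := by
  rw [← h.key]; simp only [mul_assoc]

lemma gamma_alpha (h : GrammicRel a b c) : (c * b) * (b * a) = (c * b * a) * b := by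
  calc (c * b) * (b * a) = c * (b * b * a) := by simp only [mul_assoc]
    _ = _ := by rw [← h.bab]; simp only [mul_assoc]

lemma comm_alpha_gamma (h : GrammicRel a b c) : Commute (b * a) (c * b) :=
  h.alpha_gamma.trans h.gamma_alpha.symm

lemma delta_alpha (h : GrammicRel a b c) : (c * a) * (b * a) = (c * b * a) * a := by
  calc (c * a) * (b * a) = c * (a * b * a) := by simp only [mul_assoc]
    _ = _ := by rw [h.aba]; simp only [mul_assoc]

lemma gamma_delta (h : GrammicRel a b c) : (c * b) * (c * a) = (c * b * a) * c := by
  calc (c * b) * (c * a) = c * (b * c * a) := by simp only [mul_assoc]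
    _ = _ := by rw [← h.bac]; simp only [mul_assoc]

lemma b_delta (h : GrammicRel a b c) : b * (c * a) = (b * a) * c := by
  rw [h.bac, mul_assoc]

lemma delta_b (h : GrammicRel a b c) : (c * a) * b = a * (c * b) := by
  rw [← h.acb, mul_assoc]

lemma central (h : GrammicRel a b c) (p m n j q : ℕ) :
    Commute (c * b * a) ((b * a) ^ p * ((c * a) ^ m * (a ^ n * ((c * b) ^ j * b ^ q)))) :=
  ((h.zb.mul_right h.za).pow_right _).mul_right <|
    ((h.zc.mul_right h.za).pow_right _).mul_right <|
    (h.za.pow_right _).mul_right <|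
    ((h.zc.mul_right h.zb).pow_right _).mul_right (h.zb.pow_right _)

/-- `z` may be moved to the front. -/
lemma W_z (h : GrammicRel a b c) (t p m n j q : ℕ) (x : S) :
    (c * b * a) ^ t * ((b * a) ^ p * ((c * a) ^ m * (a ^ n * ((c * b) ^ j * (b ^ q *
      ((c * b * a) * x)))))) =
    (c * b * a) ^ (t + 1) * ((b * a) ^ p * ((c * a) ^ m * (a ^ n * ((c * b) ^ j * (b ^ q * x))))) := by
  have := (h.central p m n j q).eq
  rw [pow_succ]
  calc _ = (c * b * a) ^ t * (((b * a) ^ p * ((c * a) ^ m * (a ^ n * ((c * b) ^ j * b ^ q)))) *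
      (c * b * a)) * x := by simp only [mul_assoc]
    _ = _ := by rw [← this]; simp only [mul_assoc]

lemma cpow_b (h : GrammicRel a b c) (l : ℕ) : c ^ (l + 1) * b = (c * b) * c ^ l := by
  rw [pow_succ, mul_assoc, (h.gamma_c.pow_right l).eq]

lemma cpow_a (h : GrammicRel a b c) (l : ℕ) : c ^ (l + 1) * a = (c * a) * c ^ l := by
  rw [pow_succ, mul_assoc, (h.delta_c.pow_right l).eq]

lemma bpow_cpow_a (h : GrammicRel a b c) (q l : ℕ) :
    b ^ (q + 1) * (c ^ l * a) = (b * a) * (b ^ q * c ^ l) := by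
  have hb : b * (c ^ l * a) = (b * a) * c ^ l := by
    cases l with
    | zero => simp
    | succ l => rw [h.cpow_a, ← mul_assoc, h.b_delta, mul_assoc, pow_succ']
  rw [pow_succ, mul_assoc, hb, ← mul_assoc, ← (h.alpha_b.pow_right q).eq, mul_assoc]

lemma W_mul_c (t p m n j q l : ℕ) :
    W a b c t p m n j q l * c = W a b c t p m n j q (l + 1) := by
  simp only [W, pow_succ c, mul_assoc]

lemma W_mul_b (h : GrammicRel a b c) (t p m n j q l : ℕ) : ∃ t' p' m' n' j' q' l',
    W a b c t p m n j q l * b = W a b c t' p' m' n' j' q' l' := by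
  cases l with
  | zero => exact ⟨t, p, m, n, j, q + 1, 0, by simp only [W, pow_succ b, pow_zero, mul_one, mul_assoc]⟩
  | succ l =>
    refine ⟨t, p, m, n, j + 1, q, l, ?_⟩
    have : b ^ q * (c ^ (l + 1) * b) = (c * b) * (b ^ q * c ^ l) := by
      rw [h.cpow_b, ← mul_assoc, ← (h.gamma_b.pow_right q).eq, mul_assoc]
    simp only [W]
    rw [pow_succ (c * b) j, mul_assoc ((c * b) ^ j), ← this]
    simp only [mul_assoc]

lemma W_mul_a (h : GrammicRel a b c) (t p m n j q l : ℕ) : ∃ t' p' m' n' j' q' l',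
    W a b c t p m n j q l * a = W a b c t' p' m' n' j' q' l' := by
  have e : W a b c t p m n j q l * a = (c * b * a) ^ t * ((b * a) ^ p * ((c * a) ^ m *
      (a ^ n * ((c * b) ^ j * (b ^ q * (c ^ l * a)))))) := by simp only [W, mul_assoc]
  rw [e]
  cases q with
  | succ q =>
    have e2 : a ^ n * ((c * b) ^ j * (b ^ (q + 1) * (c ^ l * a))) =
        (b * a) * (a ^ n * ((c * b) ^ j * (b ^ q * c ^ l))) := by
      have h1 := (h.comm_alpha_gamma.pow_right j).eq
      have h2 := (h.alpha_a.pow_right n).eq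
      rw [h.bpow_cpow_a]
      calc _ = a ^ n * ((c * b) ^ j * (b * a)) * (b ^ q * c ^ l) := by simp only [mul_assoc]
        _ = (a ^ n * (b * a)) * (c * b) ^ j * (b ^ q * c ^ l) := by
          rw [← h1]; simp only [mul_assoc]
        _ = _ := by rw [← h2]; simp only [mul_assoc]
    rw [e2]
    cases m with
    | zero =>
      refine ⟨t, p + 1, 0, n, j, q, l, ?_⟩
      simp only [W, pow_succ (b * a), pow_zero, one_mul, mul_assoc]
    | succ m =>
      refine ⟨t + 1, p, m, n + 1, j, q, l, ?_⟩
      have h3 := h.W_z t p m 0 0 0 (a * (a ^ n * ((c * b) ^ j * (b ^ q * c ^ l))))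
      simp only [pow_zero, one_mul] at h3
      simp only [W]
      rw [pow_succ' a n, mul_assoc a, ← h3, ← mul_assoc (c * b * a) a, ← h.delta_alpha,
        pow_succ (c * a)]
      simp only [mul_assoc]
  | zero =>
    cases l with
    | zero =>
      cases j with
      | zero =>
        refine ⟨t, p, m, n + 1, 0, 0, 0, ?_⟩
        simp only [W, pow_succ a, pow_zero, one_mul, mul_one]
      | succ j =>
        refine ⟨t + 1, p, m, n, j, 0, 0, ?_⟩
        have h3 := h.W_z t p m n j 0 1
        simp only [W, pow_zero, one_mul, mul_one] at h3 ⊢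
        rw [← h3, pow_succ (c * b)]
        simp only [mul_assoc]
    | succ l =>
      rw [h.cpow_a]
      cases j with
      | zero =>
        refine ⟨t, p, m + 1, n, 0, 0, l, ?_⟩
        have h4 := (h.delta_a.pow_right n).eq
        simp only [W, pow_zero, one_mul]
        rw [← mul_assoc (a ^ n), ← h4, pow_succ (c * a)]
        simp only [mul_assoc]
      | succ j =>
        refine ⟨t + 1, p, m, n, j, 0, l + 1, ?_⟩
        have h3 := h.W_z t p m n j 0 (c * c ^ l)
        simp only [W, pow_zero, one_mul] at h3 ⊢
        rw [pow_succ' c l, ← h3, ← mul_assoc (c * b * a) c, ← h.gamma_delta, pow_succ (c * b)]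
        simp only [mul_assoc]

lemma W_red1 (h : GrammicRel a b c) (t p m n j q l : ℕ) :
    W a b c t p (m + 1) n j (q + 1) l = W a b c t p m (n + 1) (j + 1) q l := by
  have e : (c * a) * (a ^ n * ((c * b) ^ j * b)) = a ^ n * a * ((c * b) ^ j * (c * b)) := by
    have h1 := (h.delta_a.pow_right n).eq
    have h2 := (h.gamma_b.pow_left j).eq
    rw [h2, ← mul_assoc, h1, ← pow_succ (c * b), pow_succ' (c * b)]
    calc _ = a ^ n * ((c * a) * b) * (c * b) ^ j := by simp only [mul_assoc]
      _ = _ := by rw [h.delta_b]; simp only [mul_assoc]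
  simp only [W]
  rw [pow_succ (c * a), pow_succ' b, pow_succ a, pow_succ (c * b)]
  calc _ = (c * b * a) ^ t * ((b * a) ^ p * ((c * a) ^ m *
      (((c * a) * (a ^ n * ((c * b) ^ j * b))) * (b ^ q * c ^ l)))) := by simp only [mul_assoc]
    _ = _ := by rw [e]; simp only [mul_assoc]

lemma W_red2 (h : GrammicRel a b c) (t p n j q l : ℕ) :
    W a b c t (p + 1) 0 n (j + 1) q l = W a b c (t + 1) p 0 n j (q + 1) l := by
  have h1 := (h.alpha_a.pow_right n).eq
  have h2 := (h.gamma_b.pow_left j).eq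
  have h3 := h.W_z t p 0 n 0 0 ((c * b) ^ j * (b ^ (q + 1) * c ^ l))
  simp only [pow_zero, one_mul] at h3
  simp only [W, pow_zero, one_mul]
  rw [← h3, pow_succ (b * a), pow_succ' (c * b), pow_succ' b]
  calc _ = (c * b * a) ^ t * ((b * a) ^ p * (((b * a) * a ^ n) * ((c * b) *
      ((c * b) ^ j * (b ^ q * c ^ l))))) := by simp only [mul_assoc]
    _ = (c * b * a) ^ t * ((b * a) ^ p * (a ^ n * (((b * a) * (c * b)) *
      ((c * b) ^ j * (b ^ q * c ^ l))))) := by rw [h1]; simp only [mul_assoc]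
    _ = (c * b * a) ^ t * ((b * a) ^ p * (a ^ n * ((c * b * a) * ((b *
      (c * b) ^ j) * (b ^ q * c ^ l))))) := by rw [h.alpha_gamma]; simp only [mul_assoc]
    _ = _ := by rw [← h2]; simp only [mul_assoc]

/-- Second normalization step. -/
lemma W_norm2 (h : GrammicRel a b c) (n l p : ℕ) : ∀ t j q : ℕ, ∃ t' p' j' q',
    W a b c t p 0 n j q l = W a b c t' p' 0 n j' q' l ∧ (p' = 0 ∨ j' = 0) := by
  induction p with
  | zero => exact fun t j q => ⟨t, 0, j, q, rfl, Or.inl rfl⟩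
  | succ p ih =>
    intro t j q
    cases j with
    | zero => exact ⟨t, p + 1, 0, q, rfl, Or.inr rfl⟩
    | succ j => rw [h.W_red2]; exact ih _ _ _

/-- First normalization step. -/
lemma W_norm1 (h : GrammicRel a b c) (t p l m : ℕ) : ∀ n j q : ℕ, ∃ m' n' j' q',
    W a b c t p m n j q l = W a b c t p m' n' j' q' l ∧ (m' = 0 ∨ q' = 0) := by
  induction m with
  | zero => exact fun n j q => ⟨0, n, j, q, rfl, Or.inl rfl⟩
  | succ m ih =>
    intro n j q
    cases q with
    | zero => exact ⟨m + 1, n, j, 0, rfl, Or.inr rfl⟩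
    | succ q => rw [h.W_red1]; exact ih _ _ _

lemma W_norm (h : GrammicRel a b c) (t p m n j q l : ℕ) : ∃ t' p' m' n' j' q' l',
    W a b c t p m n j q l = W a b c t' p' m' n' j' q' l' ∧ (m' = 0 ∨ q' = 0) ∧
      (m' = 0 → p' = 0 ∨ j' = 0) := by
  obtain ⟨m1, n1, j1, q1, e1, c1⟩ := h.W_norm1 t p l m n j q
  rcases Nat.eq_zero_or_pos m1 with rfl | hm
  · obtain ⟨t2, p2, j2, q2, e2, c2⟩ := h.W_norm2 n1 l p t j1 q1
    exact ⟨t2, p2, 0, n1, j2, q2, l, e1.trans e2, Or.inl rfl, fun _ => c2⟩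
  · exact ⟨t, p, m1, n1, j1, q1, l, e1, c1, fun h0 => by omega⟩

end GrammicRel

end Words

section Action

/-- The transformations of the pairs (number of `b`, number of `c`) of a row. -/
def act : Fin 3 → (ℕ × ℕ → ℕ × ℕ)
  | 0 => fun s => (s.1 - 1, s.2 - (1 - s.1))
  | 1 => fun s => (s.1 + 1, s.2 - 1)
  | 2 => fun s => (s.1, s.2 + 1)

/-- The row action, on the free monoid. -/
def rho0 : FreeMonoid (Fin 3) →* (Function.End (ℕ × ℕ))ᵐᵒᵖ :=
  FreeMonoid.lift fun x => MulOpposite.op (act x : Function.End (ℕ × ℕ))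

/-- The number of occurrences of `a`, on the free monoid. -/
def cnt0 : FreeMonoid (Fin 3) →* Multiplicative ℕ :=
  FreeMonoid.lift fun x => Multiplicative.ofAdd (if x = 0 then 1 else 0)

/-- Apply a transformation written in the opposite monoid. -/
def app (f : (Function.End (ℕ × ℕ))ᵐᵒᵖ) (s : ℕ × ℕ) : ℕ × ℕ := f.unop s

lemma app_mul (f g : (Function.End (ℕ × ℕ))ᵐᵒᵖ) (s : ℕ × ℕ) : app (f * g) s = app g (app f s) :=
  rfl

lemma app_one (s : ℕ × ℕ) : app 1 s = s := rfl

lemma app_ext {f g : (Function.End (ℕ × ℕ))ᵐᵒᵖ} (h : ∀ j k, app f (j, k) = app g (j, k)) :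
    f = g := by
  apply MulOpposite.unop_injective
  funext s
  exact h s.1 s.2

lemma app_a (j k : ℕ) : app (rho0 a) (j, k) = (j - 1, k - (1 - j)) := by
  simp only [rho0, a, FreeMonoid.lift_eval_of]; rfl
lemma app_b (j k : ℕ) : app (rho0 b) (j, k) = (j + 1, k - 1) := by
  simp only [rho0, b, FreeMonoid.lift_eval_of]; rfl
lemma app_c (j k : ℕ) : app (rho0 c) (j, k) = (j, k + 1) := by
  simp only [rho0, c, FreeMonoid.lift_eval_of]; rfl

lemma cnt_a : cnt0 a = Multiplicative.ofAdd 1 := by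
  simp [cnt0, a, FreeMonoid.lift_eval_of]
lemma cnt_b : cnt0 b = 1 := by
  simp [cnt0, b, FreeMonoid.lift_eval_of]
lemma cnt_c : cnt0 c = 1 := by
  simp [cnt0, c, FreeMonoid.lift_eval_of]

/-- The row action of the plactic monoid. -/
def rhoM : M →* (Function.End (ℕ × ℕ))ᵐᵒᵖ :=
  placticCon.lift rho0 (Con.conGen_le.2 (by
    intro x y h
    show rho0 x = rho0 y
    cases h <;> apply app_ext <;> intro j k <;>
      simp only [map_mul, app_mul, app_a, app_b, app_c, Prod.mk.injEq] <;> constructor <;> first | trivial | omega))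

/-- The number of occurrences of `a`, on the plactic monoid. -/
def cntM : M →* Multiplicative ℕ :=
  placticCon.lift cnt0 (Con.conGen_le.2 (by
    intro x y h
    show cnt0 x = cnt0 y
    cases h <;> simp only [map_mul, cnt_a, cnt_b, cnt_c, mul_one, one_mul]))

lemma rhoM_mk (w : FreeMonoid (Fin 3)) : rhoM (mk w) = rho0 w := rfl
lemma cntM_mk (w : FreeMonoid (Fin 3)) : cntM (mk w) = cnt0 w := rfl

/-- The row action of `N2`. -/
def rho : N2 →* (Function.End (ℕ × ℕ))ᵐᵒᵖ :=
  con2.lift rhoM (Con.conGen_le.2 (by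
    rintro x y ⟨rfl, rfl⟩
    show rhoM _ = rhoM _
    rw [rhoM_mk, rhoM_mk]
    apply app_ext
    intro j k
    simp only [map_mul, app_mul, app_a, app_b, app_c, Prod.mk.injEq]
    constructor <;> first | trivial | omega))

/-- The number of occurrences of `a`, on `N2`. -/
def cnt : N2 →* Multiplicative ℕ :=
  con2.lift cntM (Con.conGen_le.2 (by
    rintro x y ⟨rfl, rfl⟩
    show cntM _ = cntM _
    rw [cntM_mk, cntM_mk]
    simp only [map_mul, cnt_a, cnt_b, cnt_c, mul_one, one_mul]))

/-- The projection onto `N2`. -/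
def pr : FreeMonoid (Fin 3) →* N2 := con2.mk'.comp mk

lemma rho_pr (w : FreeMonoid (Fin 3)) : rho (pr w) = rho0 w := rfl
lemma cnt_pr (w : FreeMonoid (Fin 3)) : cnt (pr w) = cnt0 w := rfl

lemma pr_surj : Function.Surjective pr :=
  (Con.mk'_surjective (c := con2)).comp (Con.mk'_surjective (c := placticCon))

/-- The row action of the quotient of the grammic monoid. -/
def rho' : N2' →* (Function.End (ℕ × ℕ))ᵐᵒᵖ :=
  conN2'.lift rho (Con.conGen_le.2 (by
    rintro x y ⟨rfl, rfl⟩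
    show rho (pr _) = rho 1
    rw [rho_pr, map_one]
    apply app_ext
    intro j k
    simp only [map_mul, app_mul, app_a, app_b, app_c, app_one, Prod.mk.injEq]
    constructor <;> first | trivial | omega))

lemma rho'_mk (x : N2) : rho' (conN2'.mk' x) = rho x := rfl

lemma mk_rel {x y : FreeMonoid (Fin 3)} (h : KnuthRel x y) : pr x = pr y := by
  have : mk x = mk y := (Con.eq placticCon).2 (ConGen.Rel.of _ _ h)
  show con2.mk' (mk x) = con2.mk' (mk y)
  rw [this]

lemma grammicRel_pr : GrammicRel (pr a) (pr b) (pr c) where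
  aba := by simpa only [map_mul] using mk_rel KnuthRel.aba
  bab := by simpa only [map_mul] using mk_rel KnuthRel.bab
  aca := by simpa only [map_mul] using mk_rel KnuthRel.aca
  cac := by simpa only [map_mul] using mk_rel KnuthRel.cac
  cbb := by simpa only [map_mul] using mk_rel KnuthRel.cbb
  cbc := by simpa only [map_mul] using mk_rel KnuthRel.cbc
  bac := by simpa only [map_mul] using mk_rel KnuthRel.bac
  acb := by simpa only [map_mul] using mk_rel KnuthRel.acb
  key := by
    have : pr (b * a * c * b) = pr (c * b * a * b) :=
      (Con.eq con2).2 (ConGen.Rel.of _ _ ⟨rfl, rfl⟩)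
    simpa only [map_mul] using this

lemma exists_W_mul (w : FreeMonoid (Fin 3)) : ∀ t p m n j q l, ∃ t' p' m' n' j' q' l',
    W (pr a) (pr b) (pr c) t p m n j q l * pr w = W (pr a) (pr b) (pr c) t' p' m' n' j' q' l' := by
  induction w using FreeMonoid.inductionOn' with
  | one => intro t p m n j q l; exact ⟨t, p, m, n, j, q, l, by simp⟩
  | of_mul x w ih =>
    intro t p m n j q l
    have key : ∃ t' p' m' n' j' q' l', W (pr a) (pr b) (pr c) t p m n j q l * pr (FreeMonoid.of x) =
        W (pr a) (pr b) (pr c) t' p' m' n' j' q' l' := by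
      fin_cases x
      · exact grammicRel_pr.W_mul_a t p m n j q l
      · exact grammicRel_pr.W_mul_b t p m n j q l
      · exact ⟨_, _, _, _, _, _, _, GrammicRel.W_mul_c t p m n j q l⟩
    obtain ⟨t', p', m', n', j', q', l', e⟩ := key
    rw [map_mul, ← mul_assoc, e]
    exact ih _ _ _ _ _ _ _

lemma exists_normal (u : N2) : ∃ t p m n j q l, u = W (pr a) (pr b) (pr c) t p m n j q l ∧
    (m = 0 ∨ q = 0) ∧ (m = 0 → p = 0 ∨ j = 0) := by
  obtain ⟨w, rfl⟩ := pr_surj u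
  obtain ⟨t, p, m, n, j, q, l, e⟩ := exists_W_mul w 0 0 0 0 0 0 0
  obtain ⟨t', p', m', n', j', q', l', e', h⟩ := grammicRel_pr.W_norm t p m n j q l
  refine ⟨t', p', m', n', j', q', l', ?_, h⟩
  rw [← e', ← e]
  simp [W]

lemma app_pow_z (t J K : ℕ) : app ((rho0 c * rho0 b * rho0 a) ^ t) (J, K) = (J, K) := by
  induction t with
  | zero => rfl
  | succ t ih => rw [pow_succ, app_mul, ih]; simp [app_mul, app_a, app_b, app_c]

lemma app_pow_alpha (t J K : ℕ) : app ((rho0 b * rho0 a) ^ t) (J, K) = (J, K - t) := by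
  induction t with
  | zero => rfl
  | succ t ih =>
    rw [pow_succ, app_mul, ih]
    simp only [app_mul, app_a, app_b, app_c, Prod.mk.injEq]; constructor <;> first | trivial | omega

lemma app_pow_delta (t J K : ℕ) :
    app ((rho0 c * rho0 a) ^ t) (J, K) = (J - t, K + min J t) := by
  induction t with
  | zero => simp [app_one]
  | succ t ih =>
    rw [pow_succ, app_mul, ih]
    simp only [app_mul, app_a, app_b, app_c, Prod.mk.injEq]; constructor <;> first | trivial | omega

lemma app_pow_gamma (t J K : ℕ) : app ((rho0 c * rho0 b) ^ t) (J, K) = (J + t, K) := by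
  induction t with
  | zero => rfl
  | succ t ih =>
    rw [pow_succ, app_mul, ih]
    simp only [app_mul, app_a, app_b, app_c, Prod.mk.injEq]; constructor <;> first | trivial | omega

lemma app_pow_a (t J K : ℕ) : app (rho0 a ^ t) (J, K) = (J - t, K - (t - J)) := by
  induction t with
  | zero => simp [app_one]
  | succ t ih =>
    rw [pow_succ, app_mul, ih]
    simp only [app_a, Prod.mk.injEq]; constructor <;> first | trivial | omega

lemma app_pow_b (t J K : ℕ) : app (rho0 b ^ t) (J, K) = (J + t, K - t) := by
  induction t with
  | zero => rfl
  | succ t ih =>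
    rw [pow_succ, app_mul, ih]
    simp only [app_b, Prod.mk.injEq]; constructor <;> first | trivial | omega

lemma app_pow_c (t J K : ℕ) : app (rho0 c ^ t) (J, K) = (J, K + t) := by
  induction t with
  | zero => rfl
  | succ t ih =>
    rw [pow_succ, app_mul, ih]
    simp only [app_c, Prod.mk.injEq]; constructor <;> first | trivial | omega

lemma app_W (t p m n j q l J K : ℕ) : app (rho (W (pr a) (pr b) (pr c) t p m n j q l)) (J, K) =
    (J - m - n + j + q, K - p + min J m - (n - (J - m)) - q + l) := by
  simp only [W, map_mul, map_pow, rho_pr]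
  simp only [app_mul (_ ^ _), app_pow_z, app_pow_alpha, app_pow_delta, app_pow_a, app_pow_gamma,
    app_pow_b, app_pow_c]

lemma cnt_W (t p m n j q l : ℕ) :
    (cnt (W (pr a) (pr b) (pr c) t p m n j q l)).toAdd = t + p + m + n := by
  simp only [W, map_mul, map_pow, cnt_pr, cnt_a, cnt_b, cnt_c, one_mul, mul_one, one_pow]
  simp only [toAdd_mul, toAdd_pow, toAdd_ofAdd, smul_eq_mul, mul_one]
  omega

/-- The row action together with the number of `a` is faithful on `N2`. -/
lemma faithful {u v : N2} (h1 : rho u = rho v) (h2 : cnt u = cnt v) : u = v := by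
  obtain ⟨t, p, m, n, j, q, l, rfl, c1, c2⟩ := exists_normal u
  obtain ⟨t', p', m', n', j', q', l', rfl, c1', c2'⟩ := exists_normal v
  have hc : t + p + m + n = t' + p' + m' + n' := by rw [← cnt_W, h2, cnt_W]
  have hr : ∀ J K, _ := fun J K => congrArg (fun f => app f (J, K)) h1
  simp only [app_W, Prod.mk.injEq] at hr
  obtain ⟨big, hbig⟩ : ∃ N, N = p + m + n + j + q + l + (p' + m' + n' + j' + q' + l') := ⟨_, rfl⟩
  have g1 : l = l' := by have := (hr 0 0).2; omega
  have g2 : j + q = j' + q' := by have := (hr 0 0).1; omega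
  have g3 : m + n = m' + n' := by have := (hr big 0).1; clear hr; omega
  have g4 : m - q + l = m' - q' + l' := by
    have := (hr big 0).2
    rw [min_eq_right (by omega), min_eq_right (by omega)] at this
    clear hr; omega
  have g5 : p + n + q = p' + n' + q' := by
    have := (hr 0 big).2
    rw [Nat.zero_min, Nat.zero_min] at this
    clear hr; omega
  have g6 : m + (p' + q') = m' + (p + q) := by
    have := (hr big big).2
    rw [min_eq_right (by omega), min_eq_right (by omega)] at this
    clear hr; omega
  clear hr h1 h2 hbig
  have e1 : l = l' := by omega
  have e6 : m = m' := by omega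
  have e7 : t = t' ∧ p = p' ∧ n = n' ∧ j = j' ∧ q = q' := by omega
  obtain ⟨rfl, rfl, rfl, rfl, rfl⟩ := e7
  subst e1 e6
  rfl

end Action

/-- The grammic monoid `N2` and its quotient `N2' = N2/(cba = 1)` are
equationally equivalent. -/
theorem N2_equationally_equivalent_N2' :
    ∀ (X : Type*) (w w' : FreeMonoid X),
      SatisfiesId N2 w w' ↔ SatisfiesId N2' w w' := by
  intro X w w'
  constructor
  · intro h φ
    choose f hf using fun x => Con.mk'_surjective (c := conN2') (φ (FreeMonoid.of x))
    have hφ : φ = conN2'.mk'.comp (FreeMonoid.lift f) := by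
      apply FreeMonoid.hom_eq
      intro x
      rw [MonoidHom.comp_apply, FreeMonoid.lift_eval_of, hf]
    rw [hφ, MonoidHom.comp_apply, MonoidHom.comp_apply, h]
  · intro h ψ
    apply faithful
    · have := congrArg rho' (h (conN2'.mk'.comp ψ))
      simpa only [MonoidHom.comp_apply, rho'_mk] using this
    · have := congrArg (fun x => (app (rho' x) (0, 0)).2)
        (h ((powersHom N2' (conN2'.mk' (pr c))).comp (cnt.comp ψ)))
      simpa only [MonoidHom.comp_apply, powersHom_apply, map_pow, rho'_mk, rho_pr, app_pow_c,
        zero_add, EmbeddingLike.apply_eq_iff_eq] using this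

end Plactic
end
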